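/- Let t, c₁, c₁', c₂, c₂', c₁₂ and x₁, y₁, z₁, x₂, y₂, z₂ be real numbers such that for j = 1, 2: x_j² + y_j² + z_j² + 1 = 2·z_j·c_j', x_j² + y_j² + z_j² + t² = 2·t·z_j·c_j, and t·c_j ≠ c_j'; suppose moreover (x₂ − x₁)² + (y₂ − y₁)² = 2·z₁·z₂·c₁₂ − z₁² − z₂². Then x₁·x₂ + y₁·y₂ = (1/2)·[ (t² − 1)·c₁'/(t·c₁ − c₁') + (t² − 1)·c₂'/(t·c₂ − c₂') − (t² − 1)²·c₁₂ / (2·(t·c₁ − c₁')·(t·c₂ − c₂')) − 2 ]. -/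

import Mathlib

/-- Expression of `x₁ x₂ + y₁ y₂` through the edge lengths of the suspension. -/
theorem inner_prod_via_edge_lengths (t c₁ c₁' c₂ c₂' c₁₂ x₁ y₁ z₁ x₂ y₂ z₂ : ℝ)
    (h1 : x₁ ^ 2 + y₁ ^ 2 + z₁ ^ 2 + 1 = 2 * z₁ * c₁')
    (h1' : x₁ ^ 2 + y₁ ^ 2 + z₁ ^ 2 + t ^ 2 = 2 * t * z₁ * c₁)
    (h1'' : t * c₁ ≠ c₁')
    (h2 : x₂ ^ 2 + y₂ ^ 2 + z₂ ^ 2 + 1 = 2 * z₂ * c₂')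
    (h2' : x₂ ^ 2 + y₂ ^ 2 + z₂ ^ 2 + t ^ 2 = 2 * t * z₂ * c₂)
    (h2'' : t * c₂ ≠ c₂')
    (h3 : (x₂ - x₁) ^ 2 + (y₂ - y₁) ^ 2 = 2 * z₁ * z₂ * c₁₂ - z₁ ^ 2 - z₂ ^ 2) :
    x₁ * x₂ + y₁ * y₂ = (1 / 2) *
      ((t ^ 2 - 1) * c₁' / (t * c₁ - c₁') + (t ^ 2 - 1) * c₂' / (t * c₂ - c₂')
        - (t ^ 2 - 1) ^ 2 * c₁₂ / (2 * (t * c₁ - c₁') * (t * c₂ - c₂')) - 2) := by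
  have hd₁ : t * c₁ - c₁' ≠ 0 := sub_ne_zero.mpr h1''
  have hd₂ : t * c₂ - c₂' ≠ 0 := sub_ne_zero.mpr h2''
  have ht₁ : t ^ 2 - 1 = 2 * z₁ * (t * c₁ - c₁') := by linarith
  have ht₂ : t ^ 2 - 1 = 2 * z₂ * (t * c₂ - c₂') := by linarith
  have e₁ : (t ^ 2 - 1) * c₁' / (t * c₁ - c₁') = 2 * z₁ * c₁' := by
    rw [div_eq_iff hd₁, ht₁]
    ring
  have e₂ : (t ^ 2 - 1) * c₂' / (t * c₂ - c₂') = 2 * z₂ * c₂' := by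
    rw [div_eq_iff hd₂, ht₂]
    ring
  have e₃ : (t ^ 2 - 1) ^ 2 * c₁₂ / (2 * (t * c₁ - c₁') * (t * c₂ - c₂')) =
      2 * z₁ * z₂ * c₁₂ := by
    rw [div_eq_iff (mul_ne_zero (mul_ne_zero two_ne_zero hd₁) hd₂), sq (t ^ 2 - 1)]
    nth_rewrite 1 [ht₁]
    rw [ht₂]
    ring
  rw [e₁, e₂, e₃]
  linarith
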